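/- Let H be the family of halfspace classifiers of ℝ^d, let B ⊆ ℝ^d be a nonempty, closed, convex, origin-symmetric set with maximal contained linear subspace V_B, and let R = {(x,y) : y − x ∈ B}. Then AVC(H,R) ≤ d + 1 − dim(V_B); that is, for every n > d + 1 − dim(V_B) and every n-tuple of labeled points in ℝ^d × {−1,1}, the corrupted loss class of H fails to achieve at least one of the 2^n loss patterns. -/

import Mathlib

open scoped RealInnerProductSpace ENNReal

attribute [local instance] Classical.propDecidable

/-- The sign function with values in `{-1, 1, ⊥}`, encoded in `Option ℤ`:
`sgn t = some 1` for `t > 0`, `some (-1)` for `t < 0`, and `none` (i.e. `⊥`) for `t = 0`. -/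
noncomputable def sgn' (t : ℝ) : Option ℤ :=
  if 0 < t then some 1 else if t < 0 then some (-1) else none

/-- The halfspace classifier on `ℝ^d` determined by `(a, b)`: `x ↦ sgn(aᵀx − b)`. -/
noncomputable def halfspace {d : ℕ} (a : EuclideanSpace ℝ (Fin d)) (b : ℝ) :
    EuclideanSpace ℝ (Fin d) → Option ℤ :=
  fun x => sgn' (⟪a, x⟫ - b)

/-- The corrupted hypothesis `κ_R(h)` for the constraint `R = {(x,y) : y − x ∈ B}`
(so `N(x) = x + B`): it maps `x` to `some c` (for `c ∈ {-1,1}`) if `h y = some c` for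
all `y ∈ N(x)`, and to `none` (i.e. `⊥`) otherwise. -/
noncomputable def corruptB {d : ℕ} (B : Set (EuclideanSpace ℝ (Fin d)))
    (h : EuclideanSpace ℝ (Fin d) → Option ℤ) (x : EuclideanSpace ℝ (Fin d)) : Option ℤ :=
  if ∀ y, y - x ∈ B → h y = some 1 then some 1
  else if ∀ y, y - x ∈ B → h y = some (-1) then some (-1)
  else none

/-- The corrupted loss class of the halfspace classifiers,
`{(y,c) ↦ 1(κ_R(h)(y) ≠ c) : h halfspace}` with `1(⊥ ≠ c) = 1`, achieves all `2^n` loss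
patterns on some `n`-tuple of labeled points in `ℝ^d × {-1,1}`. -/
def halfspaceCorruptShatters (d : ℕ) (B : Set (EuclideanSpace ℝ (Fin d))) (n : ℕ) : Prop :=
  ∃ (x : Fin n → EuclideanSpace ℝ (Fin d)) (c : Fin n → ℤ),
    (∀ j : Fin n, c j = -1 ∨ c j = 1) ∧
    ∀ η : Fin n → Bool, ∃ (a : EuclideanSpace ℝ (Fin d)) (b : ℝ),
      ∀ j : Fin n, (corruptB B (halfspace a b) (x j) ≠ some (c j)) ↔ η j = true

theorem sgn'_eq_some_one_iff (t : ℝ) : sgn' t = some 1 ↔ 0 < t := by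
  unfold sgn'
  split_ifs <;> simp_all

theorem sgn'_eq_some_neg_one_iff (t : ℝ) : sgn' t = some (-1) ↔ t < 0 := by
  unfold sgn'
  split_ifs with h₁ h₂
  · simp [h₁.le]
  · simp [h₂]
  · simp [h₂]

/-- For a nonempty symmetric `B`, the corrupted halfspace classifier outputs `c` at `x` iff the
signed margin of `x` exceeds `⟪a, z⟫` for every `z ∈ B`. -/
theorem corruptB_halfspace_eq_some_iff {d : ℕ} {B : Set (EuclideanSpace ℝ (Fin d))}
    (hBne : B.Nonempty) (hBsym : ∀ z ∈ B, -z ∈ B) (a : EuclideanSpace ℝ (Fin d)) (b : ℝ)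
    (x : EuclideanSpace ℝ (Fin d)) {c : ℤ} (hc : c = -1 ∨ c = 1) :
    corruptB B (halfspace a b) x = some c ↔ ∀ z ∈ B, ⟪a, z⟫ < c * (⟪a, x⟫ - b) := by
  have h_pos : (∀ y, y - x ∈ B → halfspace a b y = some 1) ↔
      ∀ z ∈ B, ⟪a, z⟫ < ⟪a, x⟫ - b := by
    simp only [halfspace, sgn'_eq_some_one_iff]
    refine ⟨fun h z hz => ?_, fun h y hy => ?_⟩
    · have := h (x + -z) (by simpa using hBsym z hz)
      rw [inner_add_right, inner_neg_right] at this
      linarith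
    · have := h _ (hBsym _ hy)
      rw [inner_neg_right, inner_sub_right] at this
      linarith
  have h_neg : (∀ y, y - x ∈ B → halfspace a b y = some (-1)) ↔
      ∀ z ∈ B, ⟪a, z⟫ < -(⟪a, x⟫ - b) := by
    simp only [halfspace, sgn'_eq_some_neg_one_iff]
    refine ⟨fun h z hz => ?_, fun h y hy => ?_⟩
    · have := h (x + z) (by simpa using hz)
      rw [inner_add_right] at this
      linarith
    · have := h _ hy
      rw [inner_sub_right] at this
      linarith
  unfold corruptB
  rw [h_pos, h_neg]
  rcases hc with rfl | rfl
  · have h_excl : (∀ z ∈ B, ⟪a, z⟫ < -(⟪a, x⟫ - b)) → ¬ ∀ z ∈ B, ⟪a, z⟫ < ⟪a, x⟫ - b := by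
      intro h₁ h₂
      obtain ⟨z, hz⟩ := hBne
      have h₃ := h₁ z hz
      have h₄ := h₂ _ (hBsym z hz)
      rw [inner_neg_right] at h₄
      have h₅ := h₂ z hz
      have h₆ := h₁ _ (hBsym z hz)
      rw [inner_neg_right] at h₆
      linarith
    have h_cast : ((-1 : ℤ) : ℝ) * (⟪a, x⟫ - b) = -(⟪a, x⟫ - b) := by push_cast; ring
    rw [h_cast]
    split_ifs with h₁ h₂
    · exact iff_of_false (by simp) fun h => h_excl h h₁
    · exact iff_of_true rfl h₂
    · exact iff_of_false (by simp) h₂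
  · rw [Int.cast_one, one_mul]
    split_ifs with h₁ h₂
    · exact iff_of_true rfl h₁
    · exact iff_of_false (by simp) h₁
    · exact iff_of_false (by simp) h₁

/-- A functional bounded above on a subspace vanishes on it. -/
theorem inner_eq_zero_of_forall_inner_lt {E : Type*} [NormedAddCommGroup E]
    [InnerProductSpace ℝ E] {V : Submodule ℝ E} {a : E} {r : ℝ}
    (h : ∀ v ∈ V, ⟪a, v⟫ < r) {v : E} (hv : v ∈ V) : ⟪a, v⟫ = 0 := by
  by_contra hne
  have := h _ (V.smul_mem (r / ⟪a, v⟫) hv)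
  rw [inner_smul_right, div_mul_cancel₀ _ hne] at this
  exact lt_irrefl _ this

/-- More than `dim E + 1 - dim V` signed points of `E × ℝ` are linearly dependent modulo
`V × 0`, with a dependence whose coefficients have nonnegative sum. -/
theorem exists_dependence_mod_submodule {E : Type*} [AddCommGroup E] [Module ℝ E]
    [FiniteDimensional ℝ E] (V : Submodule ℝ E) {n : ℕ}
    (hn : Module.finrank ℝ E + 1 - Module.finrank ℝ V < n) (x : Fin n → E) (c : Fin n → ℝ) :
    ∃ l : Fin n → ℝ, ∑ j, (l j * c j) • x j ∈ V ∧ ∑ j, l j * c j = 0 ∧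
      0 ≤ ∑ j, l j ∧ ∃ j, 0 < l j := by
  have h_dep : ¬ LinearIndependent ℝ fun j => c j • ((V.mkQ (x j), 1) : (E ⧸ V) × ℝ) := by
    intro h
    have h_card := h.fintype_card_le_finrank
    have h_add := V.finrank_quotient_add_finrank
    rw [Module.finrank_prod, Module.finrank_self, Fintype.card_fin] at h_card
    omega
  obtain ⟨g, hg, i, hi⟩ := Fintype.not_linearIndependent_iff.1 h_dep
  have h_fst : ∑ j, (g j * c j) • x j ∈ V := by
    have := congrArg Prod.fst hg
    rw [← V.ker_mkQ, LinearMap.mem_ker, map_sum]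
    simpa [Prod.fst_sum, smul_smul] using this
  have h_snd : ∑ j, g j * c j = 0 := by
    simpa [Prod.snd_sum] using congrArg Prod.snd hg
  have h_pos : ∀ l : Fin n → ℝ, l i ≠ 0 → 0 ≤ ∑ j, l j → ∃ j, 0 < l j := by
    intro l hl h_sum
    by_contra! h
    have h_zero := (Finset.sum_eq_zero_iff_of_nonpos fun j _ => h j).1
      (le_antisymm (Finset.sum_nonpos fun j _ => h j) h_sum)
    exact hl (h_zero i (Finset.mem_univ i))
  rcases le_total 0 (∑ j, g j) with h | h
  · exact ⟨g, h_fst, h_snd, h, h_pos g hi h⟩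
  · have h' : 0 ≤ ∑ j, -g j := by rw [Finset.sum_neg_distrib]; linarith
    refine ⟨fun j => -g j, ?_, ?_, h', h_pos _ (neg_ne_zero.2 hi) h'⟩
    · simpa [neg_mul, neg_smul, Finset.sum_neg_distrib] using h_fst
    · simpa [neg_mul, Finset.sum_neg_distrib] using h_snd

/-- **Upper bound on the adversarial VC-dimension of halfspace classifiers:**
`AVC(H,R) ≤ d + 1 − dim V_B`.  For every `n > d + 1 − dim V_B` and every `n`-tuple of
labeled points in `ℝ^d × {-1,1}`, the corrupted loss class of the halfspace classifiers
fails to achieve at least one of the `2^n` loss patterns. -/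
theorem adversarial_vc_dimension_halfspaces_upper_bound
    (d : ℕ) (B : Set (EuclideanSpace ℝ (Fin d)))
    (hBne : B.Nonempty) (hBcl : IsClosed B) (hBconv : Convex ℝ B)
    (hBsym : ∀ z ∈ B, -z ∈ B)
    (V : Submodule ℝ (EuclideanSpace ℝ (Fin d)))
    (hVB : (V : Set (EuclideanSpace ℝ (Fin d))) ⊆ B)
    (hVmax : ∀ W : Submodule ℝ (EuclideanSpace ℝ (Fin d)),
      (W : Set (EuclideanSpace ℝ (Fin d))) ⊆ B → W ≤ V) :
    ∀ n : ℕ, d + 1 - Module.finrank ℝ V < n →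
      ∀ (x : Fin n → EuclideanSpace ℝ (Fin d)) (c : Fin n → ℤ),
        (∀ j : Fin n, c j = -1 ∨ c j = 1) →
        ∃ η : Fin n → Bool, ¬ ∃ (a : EuclideanSpace ℝ (Fin d)) (b : ℝ),
          ∀ j : Fin n, (corruptB B (halfspace a b) (x j) ≠ some (c j)) ↔ η j = true := by
  intro n hn x c hc
  obtain ⟨l, hlV, hl_zero, hl_sum, i, hi⟩ :=
    exists_dependence_mod_submodule V (by simpa using hn) x fun j => (c j : ℝ)
  refine ⟨fun j => decide (l j ≤ 0), ?_⟩
  rintro ⟨a, b, hab⟩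
  have h_iff : ∀ j, (∀ z ∈ B, ⟪a, z⟫ < c j * (⟪a, x j⟫ - b)) ↔ 0 < l j := by
    intro j
    rw [← corruptB_halfspace_eq_some_iff hBne hBsym a b (x j) (hc j), ← not_le]
    have := hab j
    rw [decide_eq_true_iff] at this
    exact not_iff_not.1 (by rw [not_not]; exact this)
  have h_orth : ⟪a, ∑ j, (l j * c j) • x j⟫ = 0 :=
    inner_eq_zero_of_forall_inner_lt (fun v hv => (h_iff i).2 hi v (hVB hv)) hlV
  have h_margin : ∑ j, l j * (c j * (⟪a, x j⟫ - b)) = 0 := by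
    have h_split : ∀ j, l j * (c j * (⟪a, x j⟫ - b)) =
        l j * c j * ⟪a, x j⟫ - l j * c j * b := fun j => by ring
    simp only [inner_sum, inner_smul_right] at h_orth
    simp only [h_split, Finset.sum_sub_distrib, ← Finset.sum_mul, h_orth, hl_zero]
    ring
  have h_wit : ∀ j, ∃ z ∈ B, 0 ≤ ⟪a, z⟫ ∧ (l j ≤ 0 → c j * (⟪a, x j⟫ - b) ≤ ⟪a, z⟫) := by
    intro j
    have h0 : (0 : EuclideanSpace ℝ (Fin d)) ∈ B := hVB V.zero_mem
    by_cases hj : 0 < l j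
    · exact ⟨0, h0, by simp, fun h => absurd hj h.not_gt⟩
    · have h_not := mt (h_iff j).1 hj
      push Not at h_not
      obtain ⟨z, hz, hle⟩ := h_not
      rcases le_total 0 ⟪a, z⟫ with h | h
      · exact ⟨z, hz, h, fun _ => hle⟩
      · exact ⟨0, h0, by simp, fun _ => by simpa using hle.trans h⟩
  choose z hzB hz_nonneg hz_le using h_wit
  have : Nonempty (Fin n) := ⟨i⟩
  obtain ⟨k, hk⟩ := Finite.exists_max fun j => ⟪a, z j⟫
  have h_pos : 0 < ∑ j, l j * (c j * (⟪a, x j⟫ - b) - ⟪a, z k⟫) := by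
    refine Finset.sum_pos' (fun j _ => ?_) ⟨i, Finset.mem_univ i, ?_⟩
    · rcases le_or_gt (l j) 0 with hj | hj
      · exact mul_nonneg_of_nonpos_of_nonpos hj (by linarith [hz_le j hj, hk j])
      · exact mul_nonneg hj.le (sub_nonneg.2 ((h_iff j).2 hj _ (hzB k)).le)
    · exact mul_pos hi (sub_pos.2 ((h_iff i).2 hi _ (hzB k)))
  simp only [mul_sub (l _) (_ * _) _, Finset.sum_sub_distrib, ← Finset.sum_mul, h_margin] at h_pos
  linarith [mul_nonneg hl_sum (hz_nonneg k)]
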